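/- arXiv:2211.12697 — 3 statements merged into one kernel-verified Lean document; each statement's English description precedes it below -/
import Mathlib

section
/- (Theorem 1(b)) Let α ∈ [0,1) and γ ∈ (−π/2, π/2). Then there is a unique r* ∈ (0, λ_0) such that r* Ψ'(r*)/Ψ(r*) = −(1−α) cos γ, and for every z ∈ ℂ with |z| < r* one has Re( e^{−iγ} (1 + z Ψ'(z)/Ψ(z)) ) > α cos γ. (For g(z) = zΨ(z), the quantity 1 + zΨ'(z)/Ψ(z) equals z g'(z)/g(z), so r* is the radius of γ-spirallikeness of order α of g, which corresponds to the normalization g_ν(z) = 2^ν Γ(ν+1) z^{1−ν} N_ν(z)/Q(ν).) -/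
open Real

/-- The entire function `Ψ(z) = ∏_{n≥0} (1 − z²/λ_n²)`. -/
noncomputable def PsiProd (l : ℕ → ℝ) (z : ℂ) : ℂ :=
  ∏' n : ℕ, (1 - z ^ 2 / ((l n : ℂ)) ^ 2)

/-- The radial majorant `∑ 2t²/(λ_n² − t²)` of `−zΨ'(z)/Ψ(z)` on the circle `|z| = t`. -/
noncomputable def radialSum (l : ℕ → ℝ) (t : ℝ) : ℝ :=
  ∑' n : ℕ, 2 * t ^ 2 / ((l n) ^ 2 - t ^ 2)

section

variable {l : ℕ → ℝ} {R : ℝ}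

lemma sq_sub_sq_pos_of_lt {s t : ℝ} (ht : 0 ≤ t) (h : t < s) : 0 < s ^ 2 - t ^ 2 := by
  nlinarith

lemma div_sq_sub_sq_lt {s t u : ℝ} (hs : 0 ≤ s) (hst : s < t) (htu : t < u) :
    2 * s ^ 2 / (u ^ 2 - s ^ 2) < 2 * t ^ 2 / (u ^ 2 - t ^ 2) := by
  have h1 := sq_sub_sq_pos_of_lt hs hst
  have h2 := sq_sub_sq_pos_of_lt (hs.trans hst.le) htu
  exact div_lt_div₀ (by linarith) (by linarith) (by positivity) h2

lemma summable_radialSum (hR : ∀ n, R ≤ l n) (hsum : Summable fun n => 1 / (l n) ^ 2)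
    {t : ℝ} (ht : 0 ≤ t) (htR : t < R) :
    Summable fun n => 2 * t ^ 2 / ((l n) ^ 2 - t ^ 2) := by
  have hR' := sq_sub_sq_pos_of_lt ht htR
  refine .of_nonneg_of_le (fun n => ?_) (fun n => ?_)
    (hsum.mul_left (2 * t ^ 2 * R ^ 2 / (R ^ 2 - t ^ 2)))
  · have := sq_sub_sq_pos_of_lt ht (htR.trans_le (hR n))
    positivity
  · have h1 := sq_sub_sq_pos_of_lt ht (htR.trans_le (hR n))
    have h2 : 0 < l n := ht.trans_lt (htR.trans_le (hR n))
    have h3 : R ^ 2 ≤ (l n) ^ 2 := pow_le_pow_left₀ (ht.trans htR.le) (hR n) 2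
    rw [div_mul_div_comm, mul_one, div_le_div_iff₀ h1 (by positivity)]
    have h4 : R ^ 2 * t ^ 2 ≤ (l n) ^ 2 * t ^ 2 := by gcongr
    nlinarith [mul_le_mul_of_nonneg_left h4 (sq_nonneg t)]

lemma radialSum_zero : radialSum l 0 = 0 := by simp [radialSum]

lemma radialSum_strictMonoOn (hR : ∀ n, R ≤ l n) (hsum : Summable fun n => 1 / (l n) ^ 2) :
    StrictMonoOn (radialSum l) (Set.Ico 0 R) := by
  intro s hs t ht hst
  have key : ∀ n, 2 * s ^ 2 / ((l n) ^ 2 - s ^ 2) < 2 * t ^ 2 / ((l n) ^ 2 - t ^ 2) :=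
    fun n => div_sq_sub_sq_lt hs.1 hst (ht.2.trans_le (hR n))
  exact Summable.tsum_lt_tsum (i := 0) (fun n => (key n).le) (key 0)
    (summable_radialSum hR hsum hs.1 hs.2) (summable_radialSum hR hsum ht.1 ht.2)

lemma radialSum_continuousOn (hR : ∀ n, R ≤ l n) (hsum : Summable fun n => 1 / (l n) ^ 2)
    {r : ℝ} (hr : 0 ≤ r) (hrR : r < R) : ContinuousOn (radialSum l) (Set.Icc 0 r) := by
  refine continuousOn_tsum (fun n => ?_) (summable_radialSum hR hsum hr hrR) fun n x hx => ?_
  · refine ContinuousOn.div (by fun_prop) (by fun_prop) fun x hx => ?_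
    exact (sq_sub_sq_pos_of_lt hx.1 (hx.2.trans_lt (hrR.trans_le (hR n)))).ne'
  · have h := sq_sub_sq_pos_of_lt hx.1 (hx.2.trans_lt (hrR.trans_le (hR n)))
    rw [Real.norm_of_nonneg (by positivity)]
    rcases hx.2.eq_or_lt with rfl | hlt
    · exact le_rfl
    · exact (div_sq_sub_sq_lt hx.1 hlt (hrR.trans_le (hR n))).le

/-- The first term of the series is unbounded near `λ_0`, so `radialSum` attains every positive
value. -/
lemma exists_radialSum_eq (h0 : 0 < l 0) (hl : ∀ n, l 0 ≤ l n)
    (hsum : Summable fun n => 1 / (l n) ^ 2) {c : ℝ} (hc : 0 < c) :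
    ∃ r ∈ Set.Ioo 0 (l 0), radialSum l r = c := by
  set q : ℝ := l 0 * √(c / (2 + c)) with hq
  have hq0 : 0 ≤ q := by positivity
  have hq2 : q ^ 2 = (l 0) ^ 2 * (c / (2 + c)) := by
    rw [hq, mul_pow, Real.sq_sqrt (by positivity)]
  have hql : q < l 0 := by
    refine mul_lt_of_lt_one_right h0 ?_
    rw [Real.sqrt_lt' one_pos, one_pow, div_lt_one (by positivity)]
    linarith
  have hterm : 2 * q ^ 2 / ((l 0) ^ 2 - q ^ 2) = c := by
    rw [div_eq_iff (sq_sub_sq_pos_of_lt hq0 hql).ne', hq2]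
    field_simp
    ring
  have hqc : c ≤ radialSum l q := by
    rw [← hterm]
    refine (summable_radialSum hl hsum hq0 hql).le_tsum 0 fun n _ => ?_
    have := sq_sub_sq_pos_of_lt hq0 (hql.trans_le (hl n))
    positivity
  obtain ⟨r, hr, hrc⟩ := intermediate_value_Icc hq0 (radialSum_continuousOn hl hsum hq0 hql)
    ⟨radialSum_zero.trans_le hc.le, hqc⟩
  refine ⟨r, ⟨hr.1.lt_of_ne ?_, hr.2.trans_lt hql⟩, hrc⟩
  rintro rfl
  exact hc.ne (radialSum_zero.symm.trans hrc)

lemma sq_sub_norm_sq_le (w : ℂ) (u : ℝ) : u ^ 2 - ‖w‖ ^ 2 ≤ ‖(u : ℂ) ^ 2 - w ^ 2‖ := by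
  have h := norm_sub_norm_le ((u : ℂ) ^ 2) (w ^ 2)
  rwa [norm_pow, norm_pow, Complex.norm_real, Real.norm_eq_abs, sq_abs] at h

lemma norm_div_sq_sub_sq_le {z : ℂ} {u : ℝ} (h : ‖z‖ < u) :
    ‖2 * z ^ 2 / ((u : ℂ) ^ 2 - z ^ 2)‖ ≤ 2 * ‖z‖ ^ 2 / (u ^ 2 - ‖z‖ ^ 2) := by
  rw [norm_div, norm_mul, norm_pow, Complex.norm_two]
  exact div_le_div_of_nonneg_left (by positivity) (sq_sub_sq_pos_of_lt (norm_nonneg z) h)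
    (sq_sub_norm_sq_le z u)

lemma norm_tsum_le_radialSum (hR : ∀ n, R ≤ l n) (hsum : Summable fun n => 1 / (l n) ^ 2)
    {z : ℂ} (hz : ‖z‖ < R) :
    ‖∑' n, 2 * z ^ 2 / ((l n : ℂ) ^ 2 - z ^ 2)‖ ≤ radialSum l ‖z‖ :=
  tsum_of_norm_bounded (summable_radialSum hR hsum (norm_nonneg z) hz).hasSum
    fun n => norm_div_sq_sub_sq_le (hz.trans_le (hR n))

lemma ofReal_sq_sub_sq_ne_zero {z : ℂ} {u : ℝ} (h : ‖z‖ < u) : (u : ℂ) ^ 2 - z ^ 2 ≠ 0 :=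
  norm_pos_iff.mp <|
    (sq_sub_sq_pos_of_lt (norm_nonneg z) h).trans_le (sq_sub_norm_sq_le z u)

lemma logDeriv_one_sub_sq_div (z : ℂ) {u : ℝ} (h : ‖z‖ < u) :
    logDeriv (fun w : ℂ => 1 + -(w ^ 2 / (u : ℂ) ^ 2)) z = -(2 * z / ((u : ℂ) ^ 2 - z ^ 2)) := by
  have hu : (u : ℂ) ≠ 0 := Complex.ofReal_ne_zero.mpr ((norm_nonneg z).trans_lt h).ne'
  have hd : HasDerivAt (fun w : ℂ => 1 + -(w ^ 2 / (u : ℂ) ^ 2)) (-(2 * z / (u : ℂ) ^ 2)) z := by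
    simpa using! (((hasDerivAt_pow 2 z).div_const ((u : ℂ) ^ 2)).neg).const_add 1
  have h1 := ofReal_sq_sub_sq_ne_zero h
  have h2 : 1 + -(z ^ 2 / (u : ℂ) ^ 2) = ((u : ℂ) ^ 2 - z ^ 2) / (u : ℂ) ^ 2 := by
    field_simp
    ring
  rw [logDeriv_apply, hd.deriv, h2]
  field_simp

lemma mul_deriv_PsiProd_div (hR : ∀ n, R ≤ l n) (hsum : Summable fun n => 1 / (l n) ^ 2)
    {z : ℂ} (hz : ‖z‖ < R) :
    z * deriv (PsiProd l) z / PsiProd l z = -∑' n, 2 * z ^ 2 / ((l n : ℂ) ^ 2 - z ^ 2) := by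
  rcases eq_or_ne z 0 with rfl | hz0
  · simp
  have hPsi : PsiProd l = fun w => ∏' n, (1 + -(w ^ 2 / (l n : ℂ) ^ 2)) := by
    funext w
    simp only [PsiProd, sub_eq_add_neg]
  have hbound : ∀ n, ∀ w ∈ Metric.ball (0 : ℂ) R,
      ‖-(w ^ 2 / (l n : ℂ) ^ 2)‖ ≤ R ^ 2 * (1 / (l n) ^ 2) := by
    intro n w hw
    have hw' : ‖w‖ ≤ R := (mem_ball_zero_iff.mp hw).le
    rw [norm_neg, norm_div, norm_pow, norm_pow, Complex.norm_real, Real.norm_eq_abs, sq_abs,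
      mul_one_div]
    gcongr
  have hmem : z ∈ Metric.ball (0 : ℂ) R := mem_ball_zero_iff.mpr hz
  have hne : ∀ n, 1 + -(z ^ 2 / (l n : ℂ) ^ 2) ≠ 0 := by
    intro n h
    have hn := hz.trans_le (hR n)
    have hu : (l n : ℂ) ≠ 0 := Complex.ofReal_ne_zero.mpr ((norm_nonneg z).trans_lt hn).ne'
    refine ofReal_sq_sub_sq_ne_zero hn ?_
    field_simp at h
    linear_combination h
  have hs : Summable fun n => 2 * z ^ 2 / ((l n : ℂ) ^ 2 - z ^ 2) :=
    .of_norm_bounded (summable_radialSum hR hsum (norm_nonneg z) hz)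
      fun n => norm_div_sq_sub_sq_le (hz.trans_le (hR n))
  have hlog : ∀ n, logDeriv (fun w : ℂ => 1 + -(w ^ 2 / (l n : ℂ) ^ 2)) z =
      -z⁻¹ * (2 * z ^ 2 / ((l n : ℂ) ^ 2 - z ^ 2)) := by
    intro n
    rw [logDeriv_one_sub_sq_div z (hz.trans_le (hR n))]
    field_simp
  have hD := logDeriv_tprod_eq_tsum (f := fun n w => 1 + -(w ^ 2 / (l n : ℂ) ^ 2))
    Metric.isOpen_ball hmem hne (fun n => by fun_prop)
    (by simpa only [hlog] using hs.mul_left (-z⁻¹))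
    (Summable.multipliableLocallyUniformlyOn_nat_one_add Metric.isOpen_ball (hsum.mul_left (R ^ 2))
      (.of_forall hbound) fun n => by fun_prop)
    (tprod_one_add_ne_zero_of_summable hne
      (.of_nonneg_of_le (fun _ => norm_nonneg _) (fun n => hbound n z hmem)
        (hsum.mul_left (R ^ 2))))
  rw [← hPsi, logDeriv_apply] at hD
  rw [mul_div_assoc, hD]
  simp only [hlog]
  rw [tsum_mul_left]
  field_simp

lemma ofReal_mul_deriv_PsiProd_div (hR : ∀ n, R ≤ l n)
    (hsum : Summable fun n => 1 / (l n) ^ 2) {t : ℝ} (ht : 0 ≤ t) (htR : t < R) :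
    (t : ℂ) * deriv (PsiProd l) t / PsiProd l t = ((-radialSum l t : ℝ) : ℂ) := by
  rw [mul_deriv_PsiProd_div hR hsum (by rwa [Complex.norm_of_nonneg ht]), radialSum]
  push_cast
  rfl

end

theorem stmt_10 (l : ℕ → ℝ) (hmono : StrictMono l) (hpos : ∀ n, 0 < l n)
    (hsum : Summable fun n => 1 / (l n) ^ 2) (α γ : ℝ)
    (hα : α ∈ Set.Ico (0 : ℝ) 1) (hγ : γ ∈ Set.Ioo (-(π / 2)) (π / 2)) :
    ∃ r : ℝ, r ∈ Set.Ioo 0 (l 0) ∧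
      ((r : ℂ) * deriv (PsiProd l) r / PsiProd l r = ((-(1 - α) * Real.cos γ : ℝ) : ℂ)) ∧
      (∀ s ∈ Set.Ioo (0 : ℝ) (l 0),
        ((s : ℂ) * deriv (PsiProd l) s / PsiProd l s = ((-(1 - α) * Real.cos γ : ℝ) : ℂ)) →
          s = r) ∧
      ∀ z : ℂ, ‖z‖ < r →
        α * Real.cos γ <
          (Complex.exp (-Complex.I * (γ : ℂ)) *
            (1 + z * deriv (PsiProd l) z / PsiProd l z)).re := by
  have hl : ∀ n, l 0 ≤ l n := fun n => hmono.monotone (Nat.zero_le n)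
  have hcos : 0 < Real.cos γ := Real.cos_pos_of_mem_Ioo hγ
  have hc : 0 < (1 - α) * Real.cos γ := mul_pos (sub_pos.mpr hα.2) hcos
  obtain ⟨r, hr, hrc⟩ := exists_radialSum_eq (hpos 0) hl hsum hc
  refine ⟨r, hr, ?_, fun s hs hsc => ?_, fun z hz => ?_⟩
  · rw [ofReal_mul_deriv_PsiProd_div hl hsum hr.1.le hr.2, hrc, neg_mul]
  · rw [ofReal_mul_deriv_PsiProd_div hl hsum hs.1.le hs.2, Complex.ofReal_inj, neg_mul,
      neg_inj, ← hrc] at hsc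
    exact (radialSum_strictMonoOn hl hsum).injOn ⟨hs.1.le, hs.2⟩ ⟨hr.1.le, hr.2⟩ hsc
  · have hzl := hz.trans hr.2
    have hlt : radialSum l ‖z‖ < (1 - α) * Real.cos γ := hrc ▸
      radialSum_strictMonoOn hl hsum ⟨norm_nonneg z, hzl⟩ ⟨hr.1.le, hr.2⟩ hz
    rw [mul_deriv_PsiProd_div hl hsum hzl]
    set S := ∑' n, 2 * z ^ 2 / ((l n : ℂ) ^ 2 - z ^ 2)
    have hE : -Complex.I * (γ : ℂ) = ((-γ : ℝ) : ℂ) * Complex.I := by push_cast; ring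
    have hre : (Complex.exp (-Complex.I * γ) * S).re ≤ radialSum l ‖z‖ := by
      refine (Complex.re_le_norm _).trans ?_
      rw [norm_mul, hE, Complex.norm_exp_ofReal_mul_I, one_mul]
      exact norm_tsum_le_radialSum hl hsum hzl
    have hexp : (Complex.exp (-Complex.I * γ)).re = Real.cos γ := by
      rw [hE, Complex.exp_ofReal_mul_I_re, Real.cos_neg]
    rw [← sub_eq_add_neg, mul_sub, mul_one, Complex.sub_re, hexp]
    linarith
end

section
/- (Theorem 1(c)) Let α ∈ [0,1) and γ ∈ (−π/2, π/2). Then there is a unique r* ∈ (0, λ_0²) such that r* Φ'(r*)/Φ(r*) = −(1−α) cos γ, and for every w ∈ ℂ with |w| < r* one has Re( e^{−iγ} (1 + w Φ'(w)/Φ(w)) ) > α cos γ. (For h(w) = wΦ(w), the quantity 1 + wΦ'(w)/Φ(w) equals w h'(w)/h(w), so r* is the radius of γ-spirallikeness of order α of h, which corresponds to the normalization h_ν(w) = 2^ν Γ(ν+1) w^{1−ν/2} N_ν(√w)/Q(ν).) -/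
open Real

/-- The entire function `Φ(w) = ∏_{n≥0} (1 − w/λ_n²)`. -/
noncomputable def PhiProd (l : ℕ → ℝ) (w : ℂ) : ℂ :=
  ∏' n : ℕ, (1 - w / ((l n : ℂ)) ^ 2)

/-- Comparison bound making `∑ s / (a n - s)` converge together with `∑ 1 / a n`. -/
lemma div_sub_le_mul_one_div {a b s : ℝ} (hs : 0 ≤ s) (hsb : s < b) (hab : b ≤ a) :
    s / (a - s) ≤ s * b / (b - s) * (1 / a) := by
  have hb : 0 < b := hs.trans_lt hsb
  have ha : 0 < a := hb.trans_le hab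
  rw [div_mul_div_comm, mul_one, div_le_div_iff₀ (by linarith) (mul_pos (by linarith) ha)]
  nlinarith [mul_nonneg (mul_nonneg hs hs) (sub_nonneg.2 hab)]

lemma div_sub_nonneg {a b s : ℝ} (hs : 0 ≤ s) (hsb : s < b) (hab : b ≤ a) :
    0 ≤ s / (a - s) :=
  div_nonneg hs (by linarith)

lemma div_sub_le_div_sub {a s t : ℝ} (hs : 0 ≤ s) (hst : s ≤ t) (hta : t < a) :
    s / (a - s) ≤ t / (a - t) :=
  div_le_div₀ (hs.trans hst) hst (by linarith) (by linarith)

lemma div_sub_lt_div_sub {a s t : ℝ} (hs : 0 ≤ s) (hst : s < t) (hta : t < a) :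
    s / (a - s) < t / (a - t) :=
  div_lt_div₀ hst (by linarith) (hs.trans hst.le) (by linarith)

lemma norm_div_ofReal_sub_le {a : ℝ} {w : ℂ} (hw : ‖w‖ < a) :
    ‖w / ((a : ℂ) - w)‖ ≤ ‖w‖ / (a - ‖w‖) := by
  rw [norm_div]
  have h : a - ‖w‖ ≤ ‖(a : ℂ) - w‖ := by
    have h1 := norm_sub_norm_le (a : ℂ) w
    rw [Complex.norm_real, Real.norm_of_nonneg ((norm_nonneg w).trans hw.le)] at h1
    exact h1
  exact div_le_div_of_nonneg_left (norm_nonneg w) (by linarith) h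

section

variable {a : ℕ → ℝ} {b : ℝ}

lemma summable_div_sub (hab : ∀ n, b ≤ a n) (hsum : Summable fun n => 1 / a n) {s : ℝ}
    (hs : 0 ≤ s) (hsb : s < b) : Summable fun n => s / (a n - s) :=
  .of_nonneg_of_le (fun n => div_sub_nonneg hs hsb (hab n))
    (fun n => div_sub_le_mul_one_div hs hsb (hab n)) (hsum.mul_left _)

lemma tsum_div_sub_lt (hab : ∀ n, b ≤ a n) (hsum : Summable fun n => 1 / a n) {s t : ℝ}
    (hs : 0 ≤ s) (hst : s < t) (htb : t < b) :
    ∑' n, s / (a n - s) < ∑' n, t / (a n - t) :=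
  Summable.tsum_lt_tsum (i := 0)
    (fun n => div_sub_le_div_sub hs hst.le (htb.trans_le (hab n)))
    (div_sub_lt_div_sub hs hst (htb.trans_le (hab 0)))
    (summable_div_sub hab hsum hs (hst.trans htb))
    (summable_div_sub hab hsum (hs.trans hst.le) htb)

lemma continuousOn_tsum_div_sub (hab : ∀ n, b ≤ a n) (hsum : Summable fun n => 1 / a n)
    {t : ℝ} (ht : 0 ≤ t) (htb : t < b) :
    ContinuousOn (fun s => ∑' n, s / (a n - s)) (Set.Icc 0 t) := by
  refine continuousOn_tsum (fun n => ?_) (summable_div_sub hab hsum ht htb) fun n s hs => ?_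
  · refine continuousOn_id.div (continuousOn_const.sub continuousOn_id) fun s hs => ?_
    have := hab n
    exact (sub_pos.2 (by linarith [hs.2] : s < a n)).ne'
  · rw [Real.norm_of_nonneg (div_sub_nonneg hs.1 (hs.2.trans_lt htb) (hab n))]
    exact div_sub_le_div_sub hs.1 hs.2 (htb.trans_le (hab n))

lemma exists_tsum_div_sub_eq (ha : 0 < a 0) (hab : ∀ n, a 0 ≤ a n)
    (hsum : Summable fun n => 1 / a n) {c : ℝ} (hc : 0 < c) :
    ∃ r ∈ Set.Ioo 0 (a 0), ∑' n, r / (a n - r) = c := by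
  set t := c * a 0 / (1 + c) with ht
  have ht0 : 0 < t := by positivity
  have hta : t < a 0 := by
    rw [ht, div_lt_iff₀ (by linarith)]
    nlinarith
  have htc : t / (a 0 - t) = c := by
    rw [div_eq_iff (by linarith), ht]
    field_simp
    ring
  have hle : c ≤ ∑' n, t / (a n - t) :=
    htc.symm.le.trans ((summable_div_sub hab hsum ht0.le hta).le_tsum 0
      fun n _ => div_sub_nonneg ht0.le hta (hab n))
  obtain ⟨r, hr, hrc⟩ := intermediate_value_Icc ht0.le
    (continuousOn_tsum_div_sub hab hsum ht0.le hta) ⟨by simpa using hc.le, hle⟩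
  refine ⟨r, ⟨hr.1.lt_of_ne ?_, hr.2.trans_lt hta⟩, hrc⟩
  rintro rfl
  simp only [zero_div, tsum_zero] at hrc
  exact hc.ne hrc

/-- The logarithmic derivative of `∏ (1 - z / a n)`, multiplied by `w`, inside the zero-free
disk. -/
lemma hasSum_mul_deriv_div_tprod (hab : ∀ n, b ≤ a n) (hsum : Summable fun n => 1 / a n)
    {w : ℂ} (hw : ‖w‖ < b) :
    HasSum (fun n => -(w / ((a n : ℂ) - w)))
      (w * deriv (fun z => ∏' n, (1 - z / (a n : ℂ))) w / ∏' n, (1 - w / (a n : ℂ))) := by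
  have hb : 0 < b := (norm_nonneg w).trans_lt hw
  have ha : ∀ n, 0 < a n := fun n => hb.trans_le (hab n)
  have haC : ∀ n, (a n : ℂ) ≠ 0 := fun n => Complex.ofReal_ne_zero.2 (ha n).ne'
  have hsub : ∀ n, (a n : ℂ) - w ≠ 0 := fun n h => by
    have h1 : ‖w‖ = a n := by
      rw [← sub_eq_zero.1 h, Complex.norm_real, Real.norm_of_nonneg (ha n).le]
    linarith [hab n]
  have hnorm : ∀ n (z : ℂ), ‖-(z / (a n : ℂ))‖ = ‖z‖ * (1 / a n) := fun n z => by
    rw [norm_neg, norm_div, Complex.norm_real, Real.norm_of_nonneg (ha n).le, mul_one_div]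
  have hne : ∀ n, 1 + -(w / (a n : ℂ)) ≠ 0 := fun n => by
    rw [← sub_eq_add_neg, one_sub_div (haC n)]
    exact div_ne_zero (hsub n) (haC n)
  have hprod : ∏' n, (1 + -(w / (a n : ℂ))) ≠ 0 :=
    tprod_one_add_ne_zero_of_summable hne (by simpa only [hnorm] using hsum.mul_left ‖w‖)
  have hlog : ∀ n, w * logDeriv (fun z : ℂ => 1 + -(z / (a n : ℂ))) w =
      -(w / ((a n : ℂ) - w)) := fun n => by
    have hd : HasDerivAt (fun z : ℂ => 1 + -(z / (a n : ℂ))) (-(1 / (a n : ℂ))) w :=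
      (((hasDerivAt_id w).div_const _).neg).const_add 1
    rw [logDeriv_apply, hd.deriv, ← sub_eq_add_neg, one_sub_div (haC n)]
    have := haC n
    have := hsub n
    field_simp
  have hterm : Summable fun n => -(w / ((a n : ℂ) - w)) :=
    (Summable.of_norm_bounded (summable_div_sub hab hsum (norm_nonneg w) hw)
      fun n => norm_div_ofReal_sub_le (hw.trans_le (hab n))).neg
  have hloc : MultipliableLocallyUniformlyOn (fun n (z : ℂ) => 1 + -(z / (a n : ℂ)))
      (Metric.ball 0 b) := by
    refine Summable.multipliableLocallyUniformlyOn_nat_one_add Metric.isOpen_ball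
      (hsum.mul_left b) (.of_forall fun n z hz => ?_) fun n => by fun_prop
    rw [hnorm]
    exact mul_le_mul_of_nonneg_right (mem_ball_zero_iff.1 hz).le (one_div_pos.2 (ha n)).le
  simp only [sub_eq_add_neg (1 : ℂ)]
  rw [mul_div_assoc, ← logDeriv_apply (fun z : ℂ => ∏' n, (1 + -(z / (a n : ℂ))))]
  rcases eq_or_ne w 0 with rfl | hw0
  · simp
  have hsl : Summable fun n => logDeriv (fun z : ℂ => 1 + -(z / (a n : ℂ))) w := by
    rw [← summable_mul_left_iff hw0]
    simpa only [hlog] using hterm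
  rw [logDeriv_tprod_eq_tsum Metric.isOpen_ball (mem_ball_zero_iff.2 hw) hne
    (fun n => by fun_prop) hsl hloc hprod, ← tsum_mul_left]
  simpa only [hlog] using hterm.hasSum

lemma mul_deriv_div_tprod_ofReal (hab : ∀ n, b ≤ a n) (hsum : Summable fun n => 1 / a n)
    {s : ℝ} (hs : 0 ≤ s) (hsb : s < b) :
    (s : ℂ) * deriv (fun z => ∏' n, (1 - z / (a n : ℂ))) s / ∏' n, (1 - (s : ℂ) / (a n : ℂ)) =
      ((-∑' n, s / (a n - s) : ℝ) : ℂ) := by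
  have hnorm : ‖(s : ℂ)‖ < b := by rwa [Complex.norm_real, Real.norm_of_nonneg hs]
  rw [← (hasSum_mul_deriv_div_tprod hab hsum hnorm).tsum_eq, tsum_neg]
  push_cast
  rfl

lemma norm_mul_deriv_div_tprod_le (hab : ∀ n, b ≤ a n) (hsum : Summable fun n => 1 / a n)
    {w : ℂ} (hw : ‖w‖ < b) :
    ‖w * deriv (fun z => ∏' n, (1 - z / (a n : ℂ))) w / ∏' n, (1 - w / (a n : ℂ))‖ ≤
      ∑' n, ‖w‖ / (a n - ‖w‖) := by
  rw [← (hasSum_mul_deriv_div_tprod hab hsum hw).tsum_eq]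
  refine tsum_of_norm_bounded (summable_div_sub hab hsum (norm_nonneg w) hw).hasSum fun n => ?_
  rw [norm_neg]
  exact norm_div_ofReal_sub_le (hw.trans_le (hab n))

end

lemma cos_sub_norm_le_re_exp_mul (γ : ℝ) (z : ℂ) :
    Real.cos γ - ‖z‖ ≤ (Complex.exp (-Complex.I * (γ : ℂ)) * (1 + z)).re := by
  have he : Complex.exp (-Complex.I * (γ : ℂ)) = Complex.exp (((-γ : ℝ) : ℂ) * Complex.I) := by
    congr 1
    push_cast
    ring
  have hz := (abs_le.1 (Complex.abs_re_le_norm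
    (Complex.exp (((-γ : ℝ) : ℂ) * Complex.I) * z))).1
  rw [norm_mul, Complex.norm_exp_ofReal_mul_I, one_mul] at hz
  rw [he, mul_add, mul_one, Complex.add_re, Complex.exp_ofReal_mul_I_re, Real.cos_neg]
  linarith

theorem stmt_11 (l : ℕ → ℝ) (hmono : StrictMono l) (hpos : ∀ n, 0 < l n)
    (hsum : Summable fun n => 1 / (l n) ^ 2) (α γ : ℝ)
    (hα : α ∈ Set.Ico (0 : ℝ) 1) (hγ : γ ∈ Set.Ioo (-(π / 2)) (π / 2)) :
    ∃ r : ℝ, r ∈ Set.Ioo 0 ((l 0) ^ 2) ∧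
      ((r : ℂ) * deriv (PhiProd l) r / PhiProd l r = ((-(1 - α) * Real.cos γ : ℝ) : ℂ)) ∧
      (∀ s ∈ Set.Ioo (0 : ℝ) ((l 0) ^ 2),
        ((s : ℂ) * deriv (PhiProd l) s / PhiProd l s = ((-(1 - α) * Real.cos γ : ℝ) : ℂ)) →
          s = r) ∧
      ∀ w : ℂ, ‖w‖ < r →
        α * Real.cos γ <
          (Complex.exp (-Complex.I * (γ : ℂ)) *
            (1 + w * deriv (PhiProd l) w / PhiProd l w)).re := by
  have hcos : 0 < Real.cos γ := Real.cos_pos_of_mem_Ioo hγ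
  have hc : 0 < (1 - α) * Real.cos γ := mul_pos (by linarith [hα.2]) hcos
  have ha : 0 < (l 0) ^ 2 := pow_pos (hpos 0) 2
  have hab : ∀ n, (l 0) ^ 2 ≤ (l n) ^ 2 := fun n =>
    pow_le_pow_left₀ (hpos 0).le (hmono.monotone (Nat.zero_le n)) 2
  have hΦ : PhiProd l = fun z => ∏' n, (1 - z / (((l n) ^ 2 : ℝ) : ℂ)) := by
    funext z
    simp only [PhiProd, Complex.ofReal_pow]
  obtain ⟨r, hr, hrc⟩ := exists_tsum_div_sub_eq (a := fun n => (l n) ^ 2) ha hab hsum hc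
  rw [hΦ]
  refine ⟨r, hr, ?_, fun s hs h => ?_, fun w hw => ?_⟩
  · rw [mul_deriv_div_tprod_ofReal hab hsum hr.1.le hr.2, hrc, neg_mul]
  · rw [mul_deriv_div_tprod_ofReal hab hsum hs.1.le hs.2, Complex.ofReal_inj, neg_mul,
      neg_inj] at h
    rcases lt_trichotomy s r with hsr | hsr | hsr
    · exact absurd (h.trans hrc.symm) (tsum_div_sub_lt hab hsum hs.1.le hsr hr.2).ne
    · exact hsr
    · exact absurd (hrc.trans h.symm) (tsum_div_sub_lt hab hsum hr.1.le hsr hs.2).ne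
  · have h1 := norm_mul_deriv_div_tprod_le hab hsum (hw.trans hr.2)
    have h2 := tsum_div_sub_lt hab hsum (norm_nonneg w) hw hr.2
    refine lt_of_lt_of_le ?_ (cos_sub_norm_le_re_exp_mul γ _)
    linarith
end

section
/- (Sufficient condition for 𝒮*(φ)-membership of g_ν) Suppose λ_0 > 1 and let β > 0 satisfy Σ_{n≥0} 2/(λ_n² − 1) < β. Then for every z ∈ ℂ with |z| < 1 one has |z Ψ'(z)/Ψ(z)| < β; equivalently, the values of z g'(z)/g(z) for g(z) = zΨ(z) lie in the disk {w : |w − 1| < β} for all z in the open unit disk, so g belongs to 𝒮*(φ) for every Ma–Minda function φ whose image contains this disk. -/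
open Real

lemma sq_sub_one_le_norm_sq_sub_sq {a : ℝ} {z : ℂ} (hz : ‖z‖ ≤ 1) :
    a ^ 2 - 1 ≤ ‖(a : ℂ) ^ 2 - z ^ 2‖ := by
  have h := norm_sub_norm_le ((a : ℂ) ^ 2) (z ^ 2)
  have h₁ : ‖(a : ℂ) ^ 2‖ = a ^ 2 := by simp [norm_pow]
  have h₂ : ‖z ^ 2‖ ≤ 1 := by
    rw [norm_pow]
    exact pow_le_one₀ (norm_nonneg z) hz
  linarith

lemma sq_sub_sq_ne_zero {a : ℝ} {z : ℂ} (ha : 1 < a) (hz : ‖z‖ ≤ 1) :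
    (a : ℂ) ^ 2 - z ^ 2 ≠ 0 := by
  rw [← norm_pos_iff]
  have := sq_sub_one_le_norm_sq_sub_sq (a := a) hz
  nlinarith

lemma one_sub_sq_div_sq_ne_zero {a : ℝ} {z : ℂ} (ha : 1 < a) (hz : ‖z‖ ≤ 1) :
    1 - z ^ 2 / (a : ℂ) ^ 2 ≠ 0 := by
  have ha₀ : (a : ℂ) ≠ 0 := by
    exact_mod_cast (zero_lt_one.trans ha).ne'
  rw [one_sub_div (pow_ne_zero 2 ha₀)]
  exact div_ne_zero (sq_sub_sq_ne_zero ha hz) (pow_ne_zero 2 ha₀)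

lemma logDeriv_one_sub_sq_div_sq {a : ℝ} {z : ℂ} (ha : 1 < a) (hz : ‖z‖ ≤ 1) :
    logDeriv (fun w : ℂ => 1 - w ^ 2 / (a : ℂ) ^ 2) z = -(2 * z) / ((a : ℂ) ^ 2 - z ^ 2) := by
  have ha₀ : (a : ℂ) ≠ 0 := by
    exact_mod_cast (zero_lt_one.trans ha).ne'
  have hd : HasDerivAt (fun w : ℂ => 1 - w ^ 2 / (a : ℂ) ^ 2) (-(2 * z / (a : ℂ) ^ 2)) z := by
    simpa using ((hasDerivAt_pow 2 z).div_const ((a : ℂ) ^ 2)).const_sub 1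
  have h₁ := sq_sub_sq_ne_zero ha hz
  rw [logDeriv_apply, hd.deriv, one_sub_div (pow_ne_zero 2 ha₀)]
  field_simp

lemma norm_logDeriv_one_sub_sq_div_sq_le {a : ℝ} {z : ℂ} (ha : 1 < a) (hz : ‖z‖ ≤ 1) :
    ‖logDeriv (fun w : ℂ => 1 - w ^ 2 / (a : ℂ) ^ 2) z‖ ≤ 2 / (a ^ 2 - 1) := by
  rw [logDeriv_one_sub_sq_div_sq ha hz, norm_div, norm_neg, norm_mul, Complex.norm_ofNat]
  have : 0 < a ^ 2 - 1 := by nlinarith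
  exact div_le_div₀ zero_le_two (by linarith) this (sq_sub_one_le_norm_sq_sub_sq hz)

lemma summable_two_div_sq_sub_one {l : ℕ → ℝ} (hmono : Monotone l) (hl0 : 1 < l 0)
    (hsum : Summable fun n => 1 / (l n) ^ 2) : Summable fun n => 2 / ((l n) ^ 2 - 1) := by
  have h₀ : 0 < l 0 ^ 2 - 1 := by nlinarith
  refine (hsum.mul_left (2 * (l 0 ^ 2 / (l 0 ^ 2 - 1)))).of_nonneg_of_le (fun n => ?_) fun n => ?_
  all_goals
    have hn : l 0 ^ 2 ≤ l n ^ 2 := by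
      have := hmono n.zero_le
      gcongr
    have hn₁ : 0 < l n ^ 2 - 1 := by linarith
  · positivity
  · have hn₂ : 0 < l n ^ 2 := by linarith
    rw [← mul_div_assoc 2 (l 0 ^ 2), div_mul_div_comm, mul_one, div_le_div_iff₀ hn₁ (by positivity)]
    nlinarith

lemma multipliableLocallyUniformlyOn_one_sub_sq_div_sq {l : ℕ → ℝ}
    (hsum : Summable fun n => 1 / (l n) ^ 2) :
    MultipliableLocallyUniformlyOn (fun n (z : ℂ) => 1 - z ^ 2 / (l n : ℂ) ^ 2)
      (Metric.ball 0 1) := by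
  simp_rw [sub_eq_add_neg]
  refine hsum.multipliableLocallyUniformlyOn_nat_one_add Metric.isOpen_ball
    (.of_forall fun n z hz => ?_) fun n => by fun_prop
  rw [norm_neg, norm_div, norm_pow, norm_pow, Complex.norm_real, Real.norm_eq_abs, sq_abs]
  gcongr
  exact pow_le_one₀ (norm_nonneg z) (mem_ball_zero_iff.mp hz).le

lemma tprod_one_sub_sq_div_sq_ne_zero {l : ℕ → ℝ} (hl : ∀ n, 1 < l n)
    (hsum : Summable fun n => 1 / (l n) ^ 2) {z : ℂ} (hz : ‖z‖ ≤ 1) :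
    ∏' n, (1 - z ^ 2 / (l n : ℂ) ^ 2) ≠ 0 := by
  have h := fun n => one_sub_sq_div_sq_ne_zero (hl n) hz
  simp_rw [sub_eq_add_neg] at h ⊢
  refine tprod_one_add_ne_zero_of_summable h ?_
  refine (hsum.mul_left (‖z‖ ^ 2)).congr fun n => ?_
  simp [div_eq_mul_inv]

theorem stmt_18 (l : ℕ → ℝ) (hmono : StrictMono l) (hpos : ∀ n, 0 < l n)
    (hsum : Summable fun n => 1 / (l n) ^ 2) (hl0 : 1 < l 0) (β : ℝ) (hβ : 0 < β)
    (hcond : ∑' n : ℕ, 2 / ((l n) ^ 2 - 1) < β) :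
    ∀ z : ℂ, ‖z‖ < 1 →
      ‖z * deriv (PsiProd l) z / PsiProd l z‖ < β := by
  intro z hz
  have hl : ∀ n, 1 < l n := fun n => hl0.trans_le (hmono.monotone n.zero_le)
  have hs := summable_two_div_sq_sub_one hmono.monotone hl0 hsum
  have hle := fun n => norm_logDeriv_one_sub_sq_div_sq_le (hl n) hz.le
  have hlog : logDeriv (PsiProd l) z =
      ∑' n, logDeriv (fun w : ℂ => 1 - w ^ 2 / (l n : ℂ) ^ 2) z :=
    logDeriv_tprod_eq_tsum Metric.isOpen_ball (mem_ball_zero_iff.mpr hz)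
      (fun n => one_sub_sq_div_sq_ne_zero (hl n) hz.le) (fun n => by fun_prop)
      (hs.of_norm_bounded hle) (multipliableLocallyUniformlyOn_one_sub_sq_div_sq hsum)
      (tprod_one_sub_sq_div_sq_ne_zero hl hsum hz.le)
  rw [mul_div_assoc, ← logDeriv_apply, hlog, norm_mul]
  calc ‖z‖ * ‖∑' n, logDeriv (fun w : ℂ => 1 - w ^ 2 / (l n : ℂ) ^ 2) z‖
      ≤ ‖∑' n, logDeriv (fun w : ℂ => 1 - w ^ 2 / (l n : ℂ) ^ 2) z‖ :=
        mul_le_of_le_one_left (norm_nonneg _) hz.le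
    _ ≤ ∑' n, 2 / ((l n) ^ 2 - 1) := tsum_of_norm_bounded hs.hasSum hle
    _ < β := hcond
end
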